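/- Let p be an odd prime and a an integer with 1 < a < p such that a does not divide p−1, and suppose the length n of the canonical continued fraction expansion a/p = [0; a_1, …, a_n] is odd. Set i := q_{n−1} − 1 and j := p − 2q_{n−1}. Then j ≥ 0, i + j ≤ p − 1, and x̂((i+1)·a/p) + x̂((j+1)·a/p) < a/p + x̂((i+j+1)·a/p); equivalently, ⌊(i+1)a/p⌋ + ⌊(j+1)a/p⌋ > ⌊(i+j+1)a/p⌋. -/

import Mathlib

/-- Part of the proof of Proposition 6.14 (odd case): let `a/p = [0; a_1, …, a_n]`
be the canonical continued fraction expansion with `1 < a < p`, `a ∤ p - 1`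
and `n` odd. Setting `i = q_{n-1} - 1` and `j = p - 2q_{n-1}`, one has
`j ≥ 0`, `i + j ≤ p - 1` and
`{(i+1)a/p} + {(j+1)a/p} < a/p + {(i+j+1)a/p}`, equivalently
`⌊(i+1)a/p⌋ + ⌊(j+1)a/p⌋ > ⌊(i+j+1)a/p⌋`. -/
theorem statement14
    (p a : ℤ) (hp : Prime p) (hodd : Odd p) (ha : 0 < a) (hap : a < p)
    (ha1 : 1 < a) (hnd : ¬ a ∣ p - 1)
    (n : ℕ) (A P Q : ℕ → ℤ)
    -- canonical continued fraction expansion a/p = [0; A 1, …, A n]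
    (hA : ∀ k, 1 ≤ k → k ≤ n → 1 ≤ A k) (hAn : 2 ≤ A n)
    -- denominators of the convergents
    (hQ0 : Q 0 = 1) (hQ1 : Q 1 = A 1)
    (hQrec : ∀ k, k + 2 ≤ n → Q (k + 2) = A (k + 2) * Q (k + 1) + Q k)
    -- numerators of the convergents
    (hP0 : P 0 = 0) (hP1 : P 1 = 1)
    (hPrec : ∀ k, k + 2 ≤ n → P (k + 2) = A (k + 2) * P (k + 1) + P k)
    -- the n-th convergent is a/p in lowest terms
    (hQn : Q n = p) (hPn : P n = a)
    (hnodd : Odd n)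
    (i j : ℤ) (hi : i = Q (n - 1) - 1) (hj : j = p - 2 * Q (n - 1)) :
    0 ≤ j ∧ i + j ≤ p - 1 ∧
      Int.fract ((((i + 1) * a : ℤ) : ℝ) / (p : ℝ)) +
          Int.fract ((((j + 1) * a : ℤ) : ℝ) / (p : ℝ)) <
        (a : ℝ) / (p : ℝ) + Int.fract ((((i + j + 1) * a : ℤ) : ℝ) / (p : ℝ)) ∧
      ⌊(((i + j + 1) * a : ℤ) : ℝ) / (p : ℝ)⌋ <
        ⌊(((i + 1) * a : ℤ) : ℝ) / (p : ℝ)⌋ + ⌊(((j + 1) * a : ℤ) : ℝ) / (p : ℝ)⌋ := by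
  have key : ∀ k, k + 1 ≤ n → 0 < Q k ∧ 0 < Q (k + 1) ∧
      P (k + 1) * Q k - P k * Q (k + 1) = (-1) ^ k := by
    intro k
    induction k with
    | zero =>
      intro h
      have h1 := hA 1 le_rfl h
      refine ⟨by omega, by simp only [zero_add]; omega, ?_⟩
      simp [hP0, hP1, hQ0]
    | succ k ih =>
      intro h
      obtain ⟨h1, h2, h3⟩ := ih (by omega)
      have h4 := hA (k + 2) (by omega) h
      have h5 := hQrec k h
      have h6 := hPrec k h
      refine ⟨h2, ?_, ?_⟩
      · show 0 < Q (k + 2)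
        rw [h5]
        have : 0 < A (k + 2) * Q (k + 1) := mul_pos (by omega) h2
        omega
      · show P (k + 2) * Q (k + 1) - P (k + 1) * Q (k + 2) = (-1) ^ (k + 1)
        rw [h5, h6, pow_succ, ← h3]
        ring
  obtain ⟨m, rfl⟩ := hnodd
  rcases m with _ | m
  · simp only [mul_zero, zero_add] at hPn
    omega
  have e : 2 * (m + 1) + 1 - 1 = 2 * (m + 1) := by omega
  rw [e] at hi hj
  obtain ⟨hq, -, hdet⟩ := key (2 * (m + 1)) le_rfl
  obtain ⟨hq', -, -⟩ := key (2 * m + 1) (by omega)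
  have hr : Q (2 * (m + 1) + 1) = A (2 * (m + 1) + 1) * Q (2 * (m + 1)) + Q (2 * m + 1) :=
    hQrec (2 * m + 1) (by omega)
  rw [hQn, hPn, pow_mul] at hdet
  rw [hQn] at hr
  norm_num at hdet
  generalize Q (2 * (m + 1)) = q at *
  generalize P (2 * (m + 1)) = b at *
  have hj0 : 0 ≤ j := by nlinarith
  have hp0 : 0 < p := by omega
  have hpR : (0 : ℝ) < p := by exact_mod_cast hp0
  have fl : ∀ x c r : ℤ, x = c * p + r → 0 ≤ r → r < p → ⌊(x : ℝ) / (p : ℝ)⌋ = c := by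
    intro x c r hx h0 h1
    have h0' : (0 : ℝ) ≤ r := by exact_mod_cast h0
    have h1' : (r : ℝ) < p := by exact_mod_cast h1
    rw [Int.floor_eq_iff, le_div_iff₀ hpR, div_lt_iff₀ hpR, hx]
    push_cast
    constructor <;> linarith
  have f1 := fl ((i + 1) * a) b 1 (by rw [hi]; linarith) (by omega) (by omega)
  have f2 := fl ((j + 1) * a) (a - 2 * b) (a - 2) (by rw [hj]; linarith) (by omega) (by omega)
  have f3 := fl ((i + j + 1) * a) (a - b - 1) (p - 1) (by rw [hi, hj]; linarith)
    (by omega) (by omega)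
  refine ⟨hj0, by omega, ?_, by rw [f1, f2, f3]; omega⟩
  simp only [Int.fract, f1, f2, f3]
  have : (((i + 1) * a : ℤ) : ℝ) / p + (((j + 1) * a : ℤ) : ℝ) / p
      = (a : ℝ) / p + (((i + j + 1) * a : ℤ) : ℝ) / p := by
    push_cast
    ring
  push_cast at this ⊢
  linarith
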